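/- arXiv:2204.08821 — 3 statements merged into one kernel-verified Lean document; each statement's English description precedes it below -/
import Mathlib

section
/- Let α > β > 0 with α² + β² = 1. Consider the two-qubit unit vectors ψ₁ = (|00⟩ + |11⟩)/√2, ψ₂ = (|00⟩ − |11⟩)/√2, φ₁ = α|00⟩ + β|11⟩, φ₂ = β|00⟩ − α|11⟩ in ℂ² ⊗ ℂ². Then there is no finite family of pairs of 2×2 complex matrices (A_k, B_k) satisfying the completeness relation ∑_k (A_k ⊗ B_k)†(A_k ⊗ B_k) = I₄ such that ∑_k (A_k ⊗ B_k)|ψ_i⟩⟨ψ_i|(A_k ⊗ B_k)† = |φ_i⟩⟨φ_i| for both i = 1 and i = 2. In particular, no separable quantum operation (and hence no LOCC operation) maps this input set of states to this output set. -/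
open Matrix BigOperators ComplexOrder Kronecker

/-- `ψ₁ = (|00⟩ + |11⟩)/√2`. -/
noncomputable def ψ₁ : Fin 2 × Fin 2 → ℂ := fun p =>
  if p = (0, 0) then (Real.sqrt 2 : ℂ)⁻¹ else if p = (1, 1) then (Real.sqrt 2 : ℂ)⁻¹ else 0

/-- `ψ₂ = (|00⟩ − |11⟩)/√2`. -/
noncomputable def ψ₂ : Fin 2 × Fin 2 → ℂ := fun p =>
  if p = (0, 0) then (Real.sqrt 2 : ℂ)⁻¹ else if p = (1, 1) then -(Real.sqrt 2 : ℂ)⁻¹ else 0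

/-- `φ₁ = α|00⟩ + β|11⟩`. -/
noncomputable def φ₁ (α β : ℝ) : Fin 2 × Fin 2 → ℂ := fun p =>
  if p = (0, 0) then (α : ℂ) else if p = (1, 1) then (β : ℂ) else 0

/-- `φ₂ = β|00⟩ − α|11⟩`. -/
noncomputable def φ₂ (α β : ℝ) : Fin 2 × Fin 2 → ℂ := fun p =>
  if p = (0, 0) then (β : ℂ) else if p = (1, 1) then -(α : ℂ) else 0

theorem aux_orth {N : ℕ} (K : Fin N → Matrix (Fin 2 × Fin 2) (Fin 2 × Fin 2) ℂ)
    (ψ φ w : Fin 2 × Fin 2 → ℂ)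
    (h : ∑ k, K k * vecMulVec ψ (star ψ) * (K k)ᴴ = vecMulVec φ (star φ))
    (hw : w ⬝ᵥ φ = 0) (k : Fin N) : w ⬝ᵥ (K k *ᵥ ψ) = 0 := by
  have e : ∀ v : Fin 2 × Fin 2 → ℂ,
      w ⬝ᵥ (vecMulVec v (star v) *ᵥ star w) = ((Complex.normSq (w ⬝ᵥ v) : ℝ) : ℂ) := by
    intro v
    rw [vecMulVec_mulVec, ← Complex.mul_conj, dotProduct_smul, star_dotProduct_star]
    simp
  have h2 : ∀ k, K k * vecMulVec ψ (star ψ) * (K k)ᴴ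
      = vecMulVec (K k *ᵥ ψ) (star (K k *ᵥ ψ)) := by
    intro k
    rw [mul_vecMulVec, vecMulVec_mul, star_mulVec]
  simp_rw [h2] at h
  have h3 := congrArg (fun M => w ⬝ᵥ (M *ᵥ star w)) h
  simp only [sum_mulVec, dotProduct_sum, e, hw] at h3
  have h4 : ∑ k, Complex.normSq (w ⬝ᵥ (K k *ᵥ ψ)) = 0 := by
    have : ((∑ k, Complex.normSq (w ⬝ᵥ (K k *ᵥ ψ)) : ℝ) : ℂ) = 0 := by
      push_cast
      simpa using h3
    exact_mod_cast this
  rw [Finset.sum_eq_zero_iff_of_nonneg (fun _ _ => Complex.normSq_nonneg _)] at h4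
  exact Complex.normSq_eq_zero.1 (h4 k (Finset.mem_univ _))

theorem aux_alg (α β p q r t : ℂ) (hα : α ≠ 0) (hβ : β ≠ 0) (hd : α ^ 2 - β ^ 2 ≠ 0)
    (hpr : p * r = 0) (hqt : q * t = 0) (e1 : β * (p + q) = α * (r + t))
    (e2 : α * (p - q) + β * (r - t) = 0) : p + q = 0 ∧ r + t = 0 := by
  have fin1 : p + q = 0 → p + q = 0 ∧ r + t = 0 := fun h => by
    rw [h, mul_zero] at e1
    exact ⟨h, (mul_eq_zero.1 e1.symm).resolve_left hα⟩
  rcases mul_eq_zero.1 hpr with h | h <;> rcases mul_eq_zero.1 hqt with h' | h' <;> subst h <;>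
    subst h'
  · exact fin1 (by simp)
  · apply fin1
    have : (α ^ 2 - β ^ 2) * q = 0 := by linear_combination -α * e2 - β * e1
    simpa [hd] using this
  · apply fin1
    have : (α ^ 2 - β ^ 2) * p = 0 := by linear_combination α * e2 - β * e1
    simpa [hd] using this
  · apply fin1
    simpa [hβ] using e1

/-- No separable quantum operation (given by a finite Kraus family of product
operators `A_k ⊗ B_k`) maps `|ψᵢ⟩⟨ψᵢ|` to `|φᵢ⟩⟨φᵢ|` for both `i = 1, 2`. -/
theorem no_separable_operation_for_set_transformation
    (α β : ℝ) (hβ : 0 < β) (hαβ : β < α) (h1 : α ^ 2 + β ^ 2 = 1) :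
    ¬ ∃ (N : ℕ) (A B : Fin N → Matrix (Fin 2) (Fin 2) ℂ),
      (∑ k, (A k ⊗ₖ B k)ᴴ * (A k ⊗ₖ B k) = 1) ∧
      (∑ k, (A k ⊗ₖ B k) * vecMulVec ψ₁ (star ψ₁) * (A k ⊗ₖ B k)ᴴ
          = vecMulVec (φ₁ α β) (star (φ₁ α β))) ∧
      (∑ k, (A k ⊗ₖ B k) * vecMulVec ψ₂ (star ψ₂) * (A k ⊗ₖ B k)ᴴ
          = vecMulVec (φ₂ α β) (star (φ₂ α β))) := by
  rintro ⟨N, A, B, -, hA, hB⟩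
  have hα : 0 < α := hβ.trans hαβ
  have hs : ((Real.sqrt 2 : ℝ) : ℂ)⁻¹ ≠ 0 := by simp
  have key : ∀ k, (A k ⊗ₖ B k) *ᵥ ψ₁ = 0 := by
    intro k
    have a1 := aux_orth _ _ _ (fun p => if p = (0, 1) then 1 else 0) hA
      (by simp [dotProduct, φ₁, Fintype.sum_prod_type]) k
    have a2 := aux_orth _ _ _ (fun p => if p = (1, 0) then 1 else 0) hA
      (by simp [dotProduct, φ₁, Fintype.sum_prod_type]) k
    have a3 := aux_orth _ _ _
      (fun p => if p = (0, 0) then (β : ℂ) else if p = (1, 1) then -(α : ℂ) else 0) hA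
      (by simp [dotProduct, φ₁, Fintype.sum_prod_type]; ring) k
    have b1 := aux_orth _ _ _ (fun p => if p = (0, 1) then 1 else 0) hB
      (by simp [dotProduct, φ₂, Fintype.sum_prod_type]) k
    have b2 := aux_orth _ _ _ (fun p => if p = (1, 0) then 1 else 0) hB
      (by simp [dotProduct, φ₂, Fintype.sum_prod_type]) k
    have b3 := aux_orth _ _ _
      (fun p => if p = (0, 0) then (α : ℂ) else if p = (1, 1) then (β : ℂ) else 0) hB
      (by simp [dotProduct, φ₂, Fintype.sum_prod_type]; ring) k
    generalize hsd : ((Real.sqrt 2 : ℝ) : ℂ)⁻¹ = s at hs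
    have hαc : (α : ℂ) ≠ 0 := by exact_mod_cast hα.ne'
    have hβc : (β : ℂ) ≠ 0 := by exact_mod_cast hβ.ne'
    have hsum : (α : ℂ) ^ 2 + (β : ℂ) ^ 2 = 1 := by exact_mod_cast h1
    have hdif : (α : ℂ) ^ 2 - (β : ℂ) ^ 2 ≠ 0 := by
      have : α ^ 2 - β ^ 2 ≠ 0 := by nlinarith
      exact_mod_cast this
    simp [dotProduct, mulVec, ψ₁, ψ₂, Fintype.sum_prod_type, hsd] at a1 a2 a3 b1 b2 b3
    ext ⟨i, j⟩
    generalize A k = a at *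
    generalize B k = b at *
    have c1 : a 0 0 * b 1 0 = 0 :=
      mul_right_cancel₀ hs (by linear_combination (a1 + b1) / 2)
    have c2 : a 0 1 * b 1 1 = 0 :=
      mul_right_cancel₀ hs (by linear_combination (a1 - b1) / 2)
    have c3 : a 1 0 * b 0 0 = 0 :=
      mul_right_cancel₀ hs (by linear_combination (a2 + b2) / 2)
    have c4 : a 1 1 * b 0 1 = 0 :=
      mul_right_cancel₀ hs (by linear_combination (a2 - b2) / 2)
    obtain ⟨d1, d2⟩ := aux_alg α β (a 0 0 * b 0 0) (a 0 1 * b 0 1) (a 1 0 * b 1 0) (a 1 1 * b 1 1)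
      hαc hβc hdif (by linear_combination (a 1 0 * b 0 0) * c1)
      (by linear_combination (a 1 1 * b 0 1) * c2)
      (mul_right_cancel₀ hs (by linear_combination a3))
      (mul_right_cancel₀ hs (by linear_combination b3))
    fin_cases i <;> fin_cases j <;> simp [dotProduct, mulVec, ψ₁, Fintype.sum_prod_type, hsd]
    · linear_combination s * d1
    · linear_combination s * (c1 + c2)
    · linear_combination s * (c3 + c4)
    · linear_combination s * d2
  simp_rw [mul_vecMulVec, key] at hA
  have := congrFun (congrFun hA (0, 0)) (0, 0)
  simp [vecMulVec_apply, φ₁, hα.ne', Matrix.sum_apply] at this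
end

section
/- Let α > β > 0 with α² + β² = 1, and let ψ₁ = (|00⟩ + |11⟩)/√2, ψ₂ = (|00⟩ − |11⟩)/√2, φ₁ = α|00⟩ + β|11⟩, φ₂ = β|00⟩ − α|11⟩ in ℂ² ⊗ ℂ². Then there do not exist 2×2 complex matrices A, B and nonzero complex numbers μ₁, μ₂ such that (A ⊗ B)ψ₁ = μ₁φ₁ and (A ⊗ B)ψ₂ = μ₂φ₂. -/
open Matrix BigOperators ComplexOrder Kronecker

/-- No product operator `A ⊗ B` maps `ψ₁ ↦ μ₁φ₁` and `ψ₂ ↦ μ₂φ₂` with both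
`μ₁, μ₂` nonzero. -/
theorem no_product_operator_both_nonzero
    (α β : ℝ) (hβ : 0 < β) (hαβ : β < α) (h1 : α ^ 2 + β ^ 2 = 1) :
    ¬ ∃ (A B : Matrix (Fin 2) (Fin 2) ℂ) (μ₁ μ₂ : ℂ), μ₁ ≠ 0 ∧ μ₂ ≠ 0 ∧
      (A ⊗ₖ B).mulVec ψ₁ = μ₁ • φ₁ α β ∧ (A ⊗ₖ B).mulVec ψ₂ = μ₂ • φ₂ α β := by
  rintro ⟨A, B, m, n, hm, hn, e1, e2⟩
  have hs : (Real.sqrt 2 : ℂ)⁻¹ ≠ 0 := by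
    apply inv_ne_zero
    exact_mod_cast (Real.sqrt_pos.mpr (by norm_num : (0:ℝ) < 2)).ne'
  have a00 := congrFun e1 (0, 0)
  have a01 := congrFun e1 (0, 1)
  have a11 := congrFun e1 (1, 1)
  have b00 := congrFun e2 (0, 0)
  have b01 := congrFun e2 (0, 1)
  have b11 := congrFun e2 (1, 1)
  simp [Matrix.mulVec, dotProduct, Fintype.sum_prod_type, ψ₁, ψ₂, φ₁, φ₂,
    -Complex.ofReal_inv] at a00 a01 a11 b00 b01 b11
  generalize (Real.sqrt 2 : ℂ)⁻¹ = s at *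
  have p01 : A 0 0 * B 1 0 * s = 0 := by linear_combination (a01 + b01) / 2
  have q01 : A 0 1 * B 1 1 * s = 0 := by linear_combination (a01 - b01) / 2
  have P : (m * α + n * β) * (m * β - n * α) = 0 := by
    have u : m * α + n * β = 2 * (A 0 0 * B 0 0 * s) := by linear_combination -a00 - b00
    have v : m * β - n * α = 2 * (A 1 0 * B 1 0 * s) := by linear_combination -a11 - b11
    rw [u, v]
    linear_combination 4 * B 0 0 * A 1 0 * s * p01
  have Q : (m * α - n * β) * (m * β + n * α) = 0 := by
    have u : m * α - n * β = 2 * (A 0 1 * B 0 1 * s) := by linear_combination -a00 + b00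
    have v : m * β + n * α = 2 * (A 1 1 * B 1 1 * s) := by linear_combination -a11 + b11
    rw [u, v]
    linear_combination 4 * B 0 1 * A 1 1 * s * q01
  have R : m * n * ((α : ℂ) ^ 2 - (β : ℂ) ^ 2) = 0 := by linear_combination (Q - P) / 2
  have T := (mul_eq_zero.mp R).resolve_left (mul_ne_zero hm hn)
  have T' : α ^ 2 - β ^ 2 = 0 := by exact_mod_cast T
  nlinarith
end

section
/- Let α > β > 0 with α² + β² = 1, and let ψ₁ = (|00⟩ + |11⟩)/√2, ψ₂ = (|00⟩ − |11⟩)/√2, φ₁ = α|00⟩ + β|11⟩, φ₂ = β|00⟩ − α|11⟩ in ℂ² ⊗ ℂ². Then there do not exist 2×2 complex matrices A, B and a nonzero complex number μ such that either ((A ⊗ B)ψ₁ = μφ₁ and (A ⊗ B)ψ₂ = 0) or ((A ⊗ B)ψ₂ = μφ₂ and (A ⊗ B)ψ₁ = 0). -/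
open Matrix BigOperators ComplexOrder Kronecker

theorem aux_rank (s m a b : ℂ) (hs : s ≠ 0) (hm : m ≠ 0) (ha : a ≠ 0) (hb : b ≠ 0)
    (p q r t p' q' r' t' : ℂ)
    (e1 : p * r * s + p' * r' * s = m * a)
    (e2 : p * t * s + p' * t' * s = 0)
    (e4 : q * t * s + q' * t' * s = m * b)
    (f1 : p * r * s = p' * r' * s)
    (f2 : p * t * s = p' * t' * s)
    (f4 : q * t * s = q' * t' * s) : False := by
  have h1 : 2 * (p * r * s) = m * a := by linear_combination e1 + f1
  have h2 : p * t * s = 0 := by linear_combination (e2 + f2) / 2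
  have h4 : 2 * (q * t * s) = m * b := by linear_combination e4 + f4
  have : (m * a) * (m * b) = 0 := by
    rw [← h1, ← h4]; linear_combination (4 * q * r * s) * h2
  simp_all

/-- No product operator `A ⊗ B` maps one of `ψ₁, ψ₂` to a nonzero multiple of the
corresponding `φᵢ` while annihilating the other. -/
theorem no_product_operator_one_zero
    (α β : ℝ) (hβ : 0 < β) (hαβ : β < α) (h1 : α ^ 2 + β ^ 2 = 1) :
    ¬ ∃ (A B : Matrix (Fin 2) (Fin 2) ℂ) (μ : ℂ), μ ≠ 0 ∧
      (((A ⊗ₖ B).mulVec ψ₁ = μ • φ₁ α β ∧ (A ⊗ₖ B).mulVec ψ₂ = 0) ∨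
       ((A ⊗ₖ B).mulVec ψ₂ = μ • φ₂ α β ∧ (A ⊗ₖ B).mulVec ψ₁ = 0)) := by
  rintro ⟨A, B, μ, hμ, h⟩
  have hs : (Real.sqrt 2 : ℂ)⁻¹ ≠ 0 := by simp
  have hb : (β : ℂ) ≠ 0 := by exact_mod_cast hβ.ne'
  have ha : (α : ℂ) ≠ 0 := by exact_mod_cast (hβ.trans hαβ).ne'
  have k1 : ∀ i j, (A ⊗ₖ B).mulVec ψ₁ (i, j)
      = A i 0 * B j 0 * (Real.sqrt 2 : ℂ)⁻¹ + A i 1 * B j 1 * (Real.sqrt 2 : ℂ)⁻¹ := by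
    intro i j
    simp [Matrix.mulVec, dotProduct, Fintype.sum_prod_type, ψ₁]
  have k2 : ∀ i j, (A ⊗ₖ B).mulVec ψ₂ (i, j)
      = A i 0 * B j 0 * (Real.sqrt 2 : ℂ)⁻¹ - A i 1 * B j 1 * (Real.sqrt 2 : ℂ)⁻¹ := by
    intro i j
    simp [Matrix.mulVec, dotProduct, Fintype.sum_prod_type, ψ₂, sub_eq_add_neg]
  generalize (Real.sqrt 2 : ℂ)⁻¹ = s at *
  rcases h with ⟨h, g⟩ | ⟨h, g⟩
  · have h' := fun i j => (k1 i j).symm.trans (congrFun h (i, j))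
    have g' := fun i j => (k2 i j).symm.trans (congrFun g (i, j))
    have e1 := h' 0 0
    have e2 := h' 0 1
    have e4 := h' 1 1
    have f1 := g' 0 0
    have f2 := g' 0 1
    have f4 := g' 1 1
    simp only [Pi.smul_apply, Pi.zero_apply, φ₁, smul_eq_mul] at e1 e2 e4 f1 f2 f4
    simp only [Prod.mk.injEq, zero_ne_one, one_ne_zero, and_true, and_false, and_self, if_true,
      if_false, mul_zero] at e1 e2 e4
    exact aux_rank s μ α β hs hμ ha hb _ _ _ _ _ _ _ _ e1 e2 e4
      (sub_eq_zero.1 f1) (sub_eq_zero.1 f2) (sub_eq_zero.1 f4)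
  · have h' := fun i j => (k2 i j).symm.trans (congrFun h (i, j))
    have g' := fun i j => (k1 i j).symm.trans (congrFun g (i, j))
    have e1 := h' 0 0
    have e2 := h' 0 1
    have e4 := h' 1 1
    have f1 := g' 0 0
    have f2 := g' 0 1
    have f4 := g' 1 1
    simp only [Pi.smul_apply, Pi.zero_apply, φ₂, smul_eq_mul] at e1 e2 e4 f1 f2 f4
    simp only [Prod.mk.injEq, zero_ne_one, one_ne_zero, and_true, and_false, and_self, if_true,
      if_false, mul_zero] at e1 e2 e4
    exact aux_rank s μ β (-α) hs hμ hb (neg_ne_zero.2 ha) (A 0 0) (A 1 0) (B 0 0) (B 1 0)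
      (-A 0 1) (-A 1 1) (B 0 1) (B 1 1)
      (by linear_combination e1) (by linear_combination e2) (by linear_combination e4)
      (by linear_combination f1) (by linear_combination f2) (by linear_combination f4)
end
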